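/- arXiv:2312.05285 — 15 statements merged into one kernel-verified Lean document; each statement's English description precedes it below -/
import Mathlib

section
/- Let S be a semigroup and let χ: S → ℂ be a multiplicative function. Suppose φ: S → ℂ is χ-additive, i.e. φ(xy) = φ(x)χ(y) + χ(x)φ(y) for all x, y ∈ S. If φ = Σ_{j=1}^{N} c_j χ_j for some constants c_1, …, c_N ∈ ℂ and multiplicative functions χ_1, …, χ_N: S → ℂ, then φ = 0. -/
open Polynomial in
/-- If a weighted sum of evaluations agrees with a multiple of the derivative at `μ` on all
monomials of positive degree, then that multiple is zero. -/
theorem eq_zero_of_sum_mul_pow_eq {ι K : Type*} [Field K] (s : Finset ι) (c a : ι → K) (μ b : K)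
    (h : ∀ n : ℕ, ∑ j ∈ s, c j * a j ^ (n + 1) = (n + 1) * μ ^ n * b) : b = 0 := by
  classical
  have key (p : K[X]) :
      ∑ j ∈ s, c j * (X * p).eval (a j) = (derivative (X * p)).eval μ * b := by
    induction p using Polynomial.induction_on' with
    | add p q hp hq =>
      simp only [mul_add, eval_add, derivative_add, Finset.sum_add_distrib, add_mul, hp, hq]
    | monomial n r =>
      calc ∑ j ∈ s, c j * (X * monomial n r).eval (a j)
          = r * ∑ j ∈ s, c j * a j ^ (n + 1) := by
            rw [Finset.mul_sum]
            refine Finset.sum_congr rfl fun j _ => ?_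
            simp only [eval_mul, eval_X, eval_monomial]
            ring
        _ = (derivative (X * monomial n r)).eval μ * b := by
            rw [h, X_mul_monomial, derivative_monomial, eval_monomial]
            push_cast
            ring
  let t : Finset K := insert 0 (insert μ (s.image a))
  have hμ : μ ∈ t := by simp [t]
  obtain ⟨p, hp⟩ : X ∣ Lagrange.nodal t id := by
    have h0 := Lagrange.eval_nodal_at_node (v := id) (show (0 : K) ∈ t by simp [t])
    rwa [X_dvd_iff, coeff_zero_eq_eval_zero]
  have hsum := key p
  rw [← hp, Finset.sum_eq_zero fun j hj => ?_] at hsum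
  · refine (mul_eq_zero.mp hsum.symm).resolve_left ?_
    have hd := Lagrange.eval_nodal_derivative_eval_node_eq (v := id) hμ
    simp only [id] at hd
    rw [hd]
    exact Lagrange.eval_nodal_not_at_node fun i hi => (Finset.ne_of_mem_erase hi).symm
  · have ha := Lagrange.eval_nodal_at_node (v := id)
      (show a j ∈ t by
        simp only [t, Finset.mem_insert]
        exact Or.inr (Or.inr (Finset.mem_image_of_mem a hj)))
    simp only [id] at ha
    rw [ha, mul_zero]

theorem chi_additive_sum_of_multiplicative_eq_zero {S : Type*} [Semigroup S]
    (χ : S → ℂ) (hχ : ∀ x y : S, χ (x * y) = χ x * χ y)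
    (φ : S → ℂ) (hφ : ∀ x y : S, φ (x * y) = φ x * χ y + χ x * φ y)
    (N : ℕ) (c : ℕ → ℂ) (χs : ℕ → S → ℂ)
    (hχs : ∀ j ∈ Finset.range N, ∀ x y : S, χs j (x * y) = χs j x * χs j y)
    (hsum : ∀ x : S, φ x = ∑ j ∈ Finset.range N, c j * χs j x) :
    φ = 0 := by
  funext x
  have hpow (n : ℕ) : ∃ y, (∀ j ∈ Finset.range N, χs j y = χs j x ^ (n + 1)) ∧
      χ y = χ x ^ (n + 1) ∧ φ y = (n + 1) * χ x ^ n * φ x := by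
    induction n with
    | zero => exact ⟨x, by simp⟩
    | succ n ih =>
      obtain ⟨y, hs, hy, hφy⟩ := ih
      refine ⟨y * x, fun j hj => ?_, ?_, ?_⟩
      · rw [hχs j hj, hs j hj, ← pow_succ]
      · rw [hχ, hy, ← pow_succ]
      · rw [hφ, hy, hφy]
        push_cast
        ring
  refine eq_zero_of_sum_mul_pow_eq (Finset.range N) c (fun j => χs j x) (χ x) (φ x) fun n => ?_
  obtain ⟨y, hs, -, hφy⟩ := hpow n
  rw [← hφy, hsum y]
  exact Finset.sum_congr rfl fun j hj => by rw [hs j hj]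
end

section
/- Let S be a semigroup and let f, g, h: S → ℂ satisfy f(xy) = f(x)g(y) + g(x)f(y) + h(x)h(y) for all x, y ∈ S, with f and h linearly independent. Then one of the following holds: (1) there exist a constant β ∈ ℂ, multiplicative functions m, χ: S → ℂ, and a χ-additive function φ: S → ℂ such that g = χ, h − βf = φ, and χ + βh = m; (2) there exist constants α ∈ ℂ∖{0}, β ∈ ℂ and a multiplicative function χ: S → ℂ such that −αf + g = χ and h(xy) = h(x)(χ + 2αf + (1/2)βh)(y) + (χ + 2αf + (1/2)βh)(x)h(y) for all x, y ∈ S; (3) there exist a constant δ ∈ ℂ and functions F, G, H: S → ℂ satisfying possibility (1) or (2) (in place of f, g, h) such that f = F, g = −(1/2)δ²F + G + δH, and h = −δF + H. -/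
/-- Possibility (1) in Proposition 3.4: there exist a constant `β`, multiplicative functions
`m, χ` and a `χ`-additive function `φ` such that `g = χ`, `h - β f = φ` and `χ + β h = m`. -/
def CosSinCase1 {S : Type*} [Semigroup S] (f g h : S → ℂ) : Prop :=
  ∃ (β : ℂ) (m χ φ : S → ℂ),
    (∀ x y : S, m (x * y) = m x * m y) ∧
    (∀ x y : S, χ (x * y) = χ x * χ y) ∧
    (∀ x y : S, φ (x * y) = φ x * χ y + χ x * φ y) ∧
    g = χ ∧
    (∀ x : S, h x - β * f x = φ x) ∧
    (∀ x : S, χ x + β * h x = m x)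

/-- Possibility (2) in Proposition 3.4: there exist constants `α ≠ 0`, `β` and a multiplicative
function `χ` such that `-α f + g = χ` and the pair `(h, χ + 2 α f + (1/2) β h)` satisfies the
sine addition law. -/
def CosSinCase2 {S : Type*} [Semigroup S] (f g h : S → ℂ) : Prop :=
  ∃ (α β : ℂ) (χ : S → ℂ),
    α ≠ 0 ∧
    (∀ x y : S, χ (x * y) = χ x * χ y) ∧
    (∀ x : S, -α * f x + g x = χ x) ∧
    (∀ x y : S, h (x * y) =
      h x * (χ y + 2 * α * f y + (1 / 2) * β * h y) +
        (χ x + 2 * α * f x + (1 / 2) * β * h x) * h y)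

/-- Two linearly independent functions are separated by a pair of points. -/
lemma exists_det_ne_zero {S : Type*} {f h : S → ℂ} (hindep : LinearIndependent ℂ ![f, h]) :
    ∃ a b : S, f a * h b - f b * h a ≠ 0 := by
  rw [LinearIndependent.pair_iff] at hindep
  by_contra! H
  have hf : ∀ a, f a = 0 := by
    intro a
    have := (hindep (-h a) (f a) (by
      funext b
      simp only [Pi.add_apply, Pi.smul_apply, smul_eq_mul, Pi.zero_apply]
      linear_combination H a b)).2
    exact this
  have := (hindep 1 0 (by funext b; simp [hf])).1
  exact one_ne_zero this

lemma eq_zero_of_forall_combination {S : Type*} {f h : S → ℂ}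
    (hindep : LinearIndependent ℂ ![f, h]) {s t : ℂ} (H : ∀ x, f x * s + h x * t = 0) :
    s = 0 ∧ t = 0 := by
  rw [LinearIndependent.pair_iff] at hindep
  refine hindep s t (funext fun x => ?_)
  simp only [Pi.add_apply, Pi.smul_apply, smul_eq_mul, Pi.zero_apply]
  linear_combination H x

/-- Separation of variables: coefficient functions on one side of a two-term identity lie in the
span of the independent functions on the other side. -/
lemma exists_combination_of_swap {S : Type*} {f h : S → ℂ}
    (hindep : LinearIndependent ℂ ![f, h]) {A B C E : S → ℂ}
    (H : ∀ x z, f z * A x + h z * B x = f x * C z + h x * E z) :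
    ∃ a b c d : ℂ, (∀ x, A x = f x * a + h x * b) ∧ (∀ x, B x = f x * c + h x * d) := by
  obtain ⟨u, v, hD⟩ := exists_det_ne_zero hindep
  refine ⟨(C u * h v - C v * h u) / (f u * h v - f v * h u),
    (E u * h v - E v * h u) / (f u * h v - f v * h u),
    (f u * C v - f v * C u) / (f u * h v - f v * h u),
    (f u * E v - f v * E u) / (f u * h v - f v * h u), fun x => ?_, fun x => ?_⟩
  · rw [← mul_div_assoc, ← mul_div_assoc, ← add_div, eq_div_iff hD]
    linear_combination h v * H x u - h u * H x v
  · rw [← mul_div_assoc, ← mul_div_assoc, ← add_div, eq_div_iff hD]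
    linear_combination f u * H x v - f v * H x u

/-- Associativity forces `g` and `h` to satisfy addition laws with constant coefficients. -/
lemma exists_addition_laws {S : Type*} [Semigroup S] {f g h : S → ℂ}
    (hfgh : ∀ x y : S, f (x * y) = f x * g y + g x * f y + h x * h y)
    (hindep : LinearIndependent ℂ ![f, h]) :
    ∃ q r s : ℂ,
      (∀ x y, g (x * y) = g x * g y + (r ^ 2 - s * q) * (f x * f y) +
        q * (f x * h y + h x * f y) + r * (h x * h y)) ∧
      (∀ x y, h (x * y) = g x * h y + h x * g y + q * (f x * f y) +
        r * (f x * h y + h x * f y) + s * (h x * h y)) := by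
  have key : ∀ y x z, f z * (g (x * y) - g x * g y) + h z * (h (x * y) - g x * h y - h x * g y) =
      f x * (g (y * z) - g y * g z) + h x * (h (y * z) - g y * h z - h y * g z) := by
    intro y x z
    have e := congrArg f (mul_assoc x y z)
    rw [hfgh, hfgh x y, hfgh x (y * z), hfgh y z] at e
    linear_combination e
  choose a b c d hG hH using fun y => exists_combination_of_swap hindep (key y)
  have rel (y z : S) : (f z * a y + h z * c y = f y * a z + h y * b z) ∧
      (f z * b y + h z * d y = f y * c z + h y * d z) := by
    have := eq_zero_of_forall_combination hindep
      (s := f z * a y + h z * c y - (f y * a z + h y * b z))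
      (t := f z * b y + h z * d y - (f y * c z + h y * d z)) (fun x => by
        have e := key y x z
        rw [hG, hH, hG, hH] at e
        linear_combination e)
    exact ⟨sub_eq_zero.mp this.1, sub_eq_zero.mp this.2⟩
  obtain ⟨a₁, a₂, c₁, c₂, ha, hc⟩ := exists_combination_of_swap hindep fun y z => (rel y z).1
  obtain ⟨b₁, b₂, d₁, d₂, hb, hd⟩ := exists_combination_of_swap hindep fun y z => (rel y z).2
  have rel₁ (y : S) := eq_zero_of_forall_combination hindep
    (s := h y * (a₂ - b₁)) (t := f y * (c₁ - a₂) + h y * (c₂ - b₂)) (fun z => by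
      have e := (rel y z).1
      rw [ha, ha, hb, hc] at e
      linear_combination e)
  have rel₂ (y : S) := eq_zero_of_forall_combination hindep
    (s := f y * (b₁ - c₁) + h y * (b₂ - d₁)) (t := f y * (d₁ - c₂)) (fun z => by
      have e := (rel y z).2
      rw [hb, hc, hd, hd] at e
      linear_combination e)
  obtain ⟨hc₁, hc₂⟩ := eq_zero_of_forall_combination hindep fun y => (rel₁ y).2
  obtain ⟨hb₁, hb₂⟩ := eq_zero_of_forall_combination hindep fun y => (rel₂ y).1
  have hg' (x y : S) : g (x * y) = g x * g y + a₁ * (f x * f y) +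
      a₂ * (f x * h y + h x * f y) + b₂ * (h x * h y) := by
    have e := hG y x
    rw [ha, hb] at e
    linear_combination e + (hb₁ + hc₁) * h x * f y
  have hh' (x y : S) : h (x * y) = g x * h y + h x * g y + a₂ * (f x * f y) +
      b₂ * (f x * h y + h x * f y) + d₂ * (h x * h y) := by
    have e := hH y x
    rw [hc, hd] at e
    linear_combination e + hc₁ * f x * f y + hc₂ * f x * h y - hb₂ * h x * f y
  obtain ⟨u, v, hD⟩ := exists_det_ne_zero hindep
  have hdefect (y : S) : (b₂ ^ 2 - d₂ * a₂ - a₁) * f y = 0 := by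
    have e := congrArg h (mul_assoc u y v)
    rw [hh', hh' u (y * v), hg', hg' y, hfgh, hfgh y, hh' u y, hh' y v] at e
    refine (mul_eq_zero.mp ?_).resolve_right hD
    linear_combination -e
  have ha₁ := (eq_zero_of_forall_combination hindep (s := b₂ ^ 2 - d₂ * a₂ - a₁) (t := 0)
    fun y => by linear_combination hdefect y).1
  refine ⟨a₂, b₂, d₂, fun x y => ?_, hh'⟩
  linear_combination hg' x y - ha₁ * f x * f y

lemma exists_cubic_root (q r s : ℂ) : ∃ t : ℂ, q = t ^ 3 - s * t ^ 2 - 2 * r * t := by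
  obtain ⟨t, ht⟩ := IsAlgClosed.exists_root
    (Polynomial.C 1 * Polynomial.X ^ 3 + Polynomial.C (-s) * Polynomial.X ^ 2 +
      Polynomial.C (-2 * r) * Polynomial.X + Polynomial.C (-q))
    (by rw [Polynomial.degree_cubic one_ne_zero]; decide)
  refine ⟨t, ?_⟩
  simp only [Polynomial.IsRoot, Polynomial.eval_add, Polynomial.eval_mul, Polynomial.eval_pow,
    Polynomial.eval_C, Polynomial.eval_X] at ht
  linear_combination -ht

lemma case_of_addition_laws {S : Type*} [Semigroup S] {f g h : S → ℂ} (r s : ℂ)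
    (hf : ∀ x y, f (x * y) = f x * g y + g x * f y + h x * h y)
    (hg : ∀ x y, g (x * y) = g x * g y + r ^ 2 * (f x * f y) + r * (h x * h y))
    (hh : ∀ x y, h (x * y) = g x * h y + h x * g y +
      r * (f x * h y + h x * f y) + s * (h x * h y)) :
    CosSinCase1 f g h ∨ CosSinCase2 f g h := by
  rcases eq_or_ne r 0 with rfl | hr
  · refine Or.inl ⟨s, fun x => g x + s * h x, g, fun x => h x - s * f x, fun x y => ?_,
      fun x y => ?_, fun x y => ?_, rfl, fun _ => rfl, fun _ => rfl⟩
    · linear_combination hg x y + s * hh x y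
    · linear_combination hg x y
    · linear_combination hh x y - s * hf x y
  · refine Or.inr ⟨r, s, fun x => -r * f x + g x, hr, fun x y => ?_, fun _ => rfl, fun x y => ?_⟩
    · linear_combination hg x y - r * hf x y
    · linear_combination hh x y

theorem cosine_sine_structure {S : Type*} [Semigroup S] (f g h : S → ℂ)
    (hfgh : ∀ x y : S, f (x * y) = f x * g y + g x * f y + h x * h y)
    (hindep : LinearIndependent ℂ ![f, h]) :
    CosSinCase1 f g h ∨ CosSinCase2 f g h ∨
      ∃ (δ : ℂ) (F G H : S → ℂ),
        (CosSinCase1 F G H ∨ CosSinCase2 F G H) ∧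
        f = F ∧
        (∀ x : S, g x = -(1 / 2) * δ ^ 2 * F x + G x + δ * H x) ∧
        (∀ x : S, h x = -δ * F x + H x) := by
  obtain ⟨q, r, s, hg, hh⟩ := exists_addition_laws hfgh hindep
  obtain ⟨t, rfl⟩ := exists_cubic_root q r s
  refine Or.inr (Or.inr ⟨-t, f, fun x => g x + t * h x - 1 / 2 * t ^ 2 * f x,
    fun x => h x - t * f x, ?_, rfl, fun x => by ring, fun x => by ring⟩)
  refine case_of_addition_laws (r + s * t - 3 / 2 * t ^ 2) (s - 3 * t)
    (fun x y => ?_) (fun x y => ?_) (fun x y => ?_)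
  · linear_combination hfgh x y
  · linear_combination hg x y + t * hh x y - 1 / 2 * t ^ 2 * hfgh x y
  · linear_combination hh x y - t * hfgh x y
end

section
/- Let S be a semigroup, σ: S → S an involutive automorphism, and let f, g, h: S → ℂ satisfy f(xσ(y)) = f(x)g(y) + g(x)f(y) + h(x)h(y) for all x, y ∈ S. Then the even part f^e of f is central, i.e. f^e(xy) = f^e(yx) for all x, y ∈ S. -/
/-- The even part of a function with respect to an involution `σ`. -/
noncomputable def evenPart {S : Type*} (σ : S → S) (f : S → ℂ) : S → ℂ :=
  fun x => (f x + f (σ x)) / 2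

/-- The odd part of a function with respect to an involution `σ`. -/
noncomputable def oddPart {S : Type*} (σ : S → S) (f : S → ℂ) : S → ℂ :=
  fun x => (f x - f (σ x)) / 2

theorem apply_mul_eq_apply_invol_mul_swap {S : Type*} [Semigroup S] (σ : S → S)
    (hσmul : ∀ x y : S, σ (x * y) = σ x * σ y) (hσinv : ∀ x : S, σ (σ x) = x)
    (f g h : S → ℂ)
    (hfgh : ∀ x y : S, f (x * σ y) = f x * g y + g x * f y + h x * h y) (x y : S) :
    f (x * y) = f (σ (y * x)) := by
  have h₁ := hfgh x (σ y)
  have h₂ := hfgh (σ y) x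
  rw [hσinv] at h₁
  rw [hσmul, h₁, h₂]
  ring

theorem evenPart_central {S : Type*} [Semigroup S] (σ : S → S)
    (hσmul : ∀ x y : S, σ (x * y) = σ x * σ y) (hσinv : ∀ x : S, σ (σ x) = x)
    (f g h : S → ℂ)
    (hfgh : ∀ x y : S, f (x * σ y) = f x * g y + g x * f y + h x * h y) :
    ∀ x y : S, evenPart σ f (x * y) = evenPart σ f (y * x) := by
  intro x y
  have key := apply_mul_eq_apply_invol_mul_swap σ hσmul hσinv f g h hfgh
  simp only [evenPart]
  rw [key x y, ← key y x, add_comm]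
end

section
/- Let S be a semigroup, σ: S → S an involutive automorphism, and let f, g, h: S → ℂ satisfy f(xσ(y)) = f(x)g(y) + g(x)f(y) + h(x)h(y) for all x, y ∈ S. Then the odd part f^o of f satisfies f^o(xy) = −f^o(yx) for all x, y ∈ S. -/
theorem oddPart_antisymm {S : Type*} [Semigroup S] (σ : S → S)
    (hσmul : ∀ x y : S, σ (x * y) = σ x * σ y) (hσinv : ∀ x : S, σ (σ x) = x)
    (f g h : S → ℂ)
    (hfgh : ∀ x y : S, f (x * σ y) = f x * g y + g x * f y + h x * h y) :
    ∀ x y : S, oddPart σ f (x * y) = - oddPart σ f (y * x) := by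
  have swap : ∀ x y : S, f (x * y) = f (σ (y * x)) := fun x y => by
    have h₁ := hfgh x (σ y)
    have h₂ := hfgh (σ y) x
    rw [hσinv] at h₁
    rw [hσmul, h₁, h₂]
    ring
  intro x y
  simp only [oddPart]
  rw [swap x y, swap y x]
  ring
end

section
/- Let S be a semigroup, σ: S → S an involutive automorphism, and let f, g, h: S → ℂ satisfy f(xσ(y)) = f(x)g(y) + g(x)f(y) + h(x)h(y) for all x, y ∈ S. Then the odd part f^o of f satisfies f^o(xyz) = 0 for all x, y, z ∈ S. -/
/-- If `(x, y) ↦ f (x * σ y)` is symmetric, then swapping two factors inside `f` amounts to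
applying `σ`. -/
theorem apply_mul_eq_apply_involution_mul_swap {S : Type*} [Mul S] {σ : S → S}
    (hσmul : ∀ x y : S, σ (x * y) = σ x * σ y) (hσinv : ∀ x : S, σ (σ x) = x)
    {f : S → ℂ} (hsymm : ∀ x y : S, f (x * σ y) = f (y * σ x)) (x y : S) :
    f (x * y) = f (σ (y * x)) := by
  rw [hσmul, ← hsymm, hσinv]

theorem oddPart_vanishes_on_triple_products {S : Type*} [Semigroup S] (σ : S → S)
    (hσmul : ∀ x y : S, σ (x * y) = σ x * σ y) (hσinv : ∀ x : S, σ (σ x) = x)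
    (f g h : S → ℂ)
    (hfgh : ∀ x y : S, f (x * σ y) = f x * g y + g x * f y + h x * h y) :
    ∀ x y z : S, oddPart σ f (x * y * z) = 0 := by
  have swap := apply_mul_eq_apply_involution_mul_swap hσmul hσinv (f := f)
    fun x y => by rw [hfgh, hfgh]; ring
  have swap' (x y : S) : f (σ (x * y)) = f (y * x) := (swap y x).symm
  intro x y z
  have key : f (x * y * z) = f (σ (x * y * z)) := by
    calc f (x * y * z) = f (σ (y * z * x)) := by rw [mul_assoc, swap]
      _ = f (z * x * y) := by rw [mul_assoc, swap']
      _ = f (σ (x * y * z)) := by rw [swap', mul_assoc]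
  simp [oddPart, ← key]
end

section
/- Let S be a semigroup, σ: S → S an involutive automorphism, and let f, g, h: S → ℂ satisfy f(xσ(y)) = f(x)g(y) + g(x)f(y) + h(x)h(y) for all x, y ∈ S. If f ≠ 0 and f∘σ = −f, then g∘σ = −g and h∘σ = −h. -/
theorem odd_f_implies_odd_g_h {S : Type*} [Semigroup S] (σ : S → S)
    (hσmul : ∀ x y : S, σ (x * y) = σ x * σ y) (hσinv : ∀ x : S, σ (σ x) = x)
    (f g h : S → ℂ)
    (hfgh : ∀ x y : S, f (x * σ y) = f x * g y + g x * f y + h x * h y)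
    (hf0 : f ≠ 0) (hfodd : ∀ x : S, f (σ x) = - f x) :
    (∀ x : S, g (σ x) = - g x) ∧ (∀ x : S, h (σ x) = - h x) := by
  obtain ⟨z, hz⟩ : ∃ z, f z ≠ 0 := Function.ne_iff.mp hf0
  have hneg : ∀ x y, f (σ x * y) = -f (x * σ y) := fun x y => by
    rw [← hfodd, hσmul, hσinv]
  have hanti : ∀ x y, f (x * y) = -f (y * x) := fun x y => by
    have h₁ := hfgh x (σ y)
    have h₂ := hfgh (σ y) x
    rw [hσinv] at h₁
    rw [hneg, hσinv] at h₂
    linear_combination h₁ - h₂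
  have hcube : ∀ x y w, f (x * y * w) = 0 := fun x y w => by
    have h₁ := hanti (x * y) w
    have h₂ := hanti (w * x) y
    have h₃ := hanti (y * w) x
    rw [← mul_assoc] at h₁ h₂ h₃
    linear_combination (h₁ - h₂ + h₃) / 2
  have hsum : ∀ x y, f x * (g y - g (σ y)) + (g x - g (σ x)) * f y
      + h x * h y + h (σ x) * h (σ y) = 0 := fun x y => by
    have h₁ := hneg x y
    have h₂ := hfgh (σ x) (σ y)
    rw [hσinv, hfodd, hfodd] at h₂
    linear_combination h₁ - h₂ - hfgh x y
  have hhodd : ∀ x, h (σ x) = -h x := fun x => by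
    have h₁ := hsum x x
    have h₂ := hsum (σ x) x
    rw [hσinv, hfodd] at h₂
    have h₃ : (h x + h (σ x)) ^ 2 = 0 := by linear_combination h₁ + h₂
    linear_combination pow_eq_zero_iff two_ne_zero |>.mp h₃
  refine ⟨?_, hhodd⟩
  have hprop : ∀ x, f z * h x = h z * f x := fun x => by
    have h₁ := hsum z z
    have h₂ := hsum x z
    have h₃ := hsum x x
    rw [hhodd] at h₁ h₂ h₃
    rw [hhodd] at h₂
    have h₄ : (f z * h x - h z * f x) ^ 2 = 0 := by
      linear_combination f x ^ 2 / 2 * h₁ - f x * f z * h₂ + f z ^ 2 / 2 * h₃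
    linear_combination pow_eq_zero_iff two_ne_zero |>.mp h₄
  obtain ⟨c, hc⟩ : ∃ c, ∀ x, h x = c * f x :=
    ⟨h z / f z, fun x => by field_simp; linear_combination hprop x⟩
  have hred : ∀ x y, f (x * σ y) =
      f x * (g y + c ^ 2 / 2 * f y) + (g x + c ^ 2 / 2 * f x) * f y := fun x y => by
    rw [hfgh, hc, hc]; ring
  obtain ⟨d, hd⟩ : ∃ d, ∀ x, g x = d * f x := by
    by_cases hsq : ∃ a b, f (a * b) ≠ 0
    · obtain ⟨a, b, hab⟩ := hsq
      refine ⟨-(g (a * b) / f (a * b)) - c ^ 2, fun x => ?_⟩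
      have h₁ := hred (a * b) x
      rw [hcube] at h₁
      field_simp
      linear_combination -h₁
    · push Not at hsq
      have h₁ : g z + c ^ 2 / 2 * f z = 0 := by
        have h₂ := hred z z
        rw [hsq] at h₂
        apply mul_left_cancel₀ hz
        linear_combination -h₂ / 2
      refine ⟨-(c ^ 2 / 2), fun x => ?_⟩
      have h₂ := hred x z
      rw [hsq, h₁] at h₂
      apply mul_right_cancel₀ hz
      linear_combination -h₂
  intro x
  rw [hd, hd, hfodd, mul_neg]
end

section
/- Let S be a semigroup, σ: S → S an involutive automorphism, and let f, g, h: S → ℂ satisfy f(xσ(y)) = f(x)g(y) + g(x)f(y) + h(x)h(y) for all x, y ∈ S. If f ≠ 0 and f∘σ = −f, then f(xy) = 0 for all x, y ∈ S and there exists a constant λ ∈ ℂ such that g = −(λ²/2)f and h = λf. -/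
theorem odd_f_solution_form {S : Type*} [Semigroup S] (σ : S → S)
    (hσmul : ∀ x y : S, σ (x * y) = σ x * σ y) (hσinv : ∀ x : S, σ (σ x) = x)
    (f g h : S → ℂ)
    (hfgh : ∀ x y : S, f (x * σ y) = f x * g y + g x * f y + h x * h y)
    (hf0 : f ≠ 0) (hfodd : ∀ x : S, f (σ x) = - f x) :
    (∀ x y : S, f (x * y) = 0) ∧
      ∃ lam : ℂ, (∀ x : S, g x = -(lam ^ 2 / 2) * f x) ∧ (∀ x : S, h x = lam * f x) := by
  have anti : ∀ x y, f (x * y) = -f (y * x) := fun x y => by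
    have h1 := hfgh x (σ y)
    have h2 := hfgh (σ y) x
    have h3 := hfodd (y * x)
    rw [hσmul] at h3
    rw [hσinv] at h1
    linear_combination h1 - h2 + h3
  have triple : ∀ x y z, f (x * y * z) = 0 := fun x y z => by
    have h1 := anti x (y * z)
    have h2 := anti y (z * x)
    have h3 := anti z (x * y)
    simp only [← mul_assoc] at h1 h2 h3
    linear_combination (h1 - h2 + h3) / 2
  have prod : ∀ x y, f (x * y) = 0 := by
    intro a b
    by_contra hab
    have hB : ∀ z, f (a * b) * g z + g (a * b) * f z + h (a * b) * h z = 0 := fun z => by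
      rw [← hfgh, triple]
    have hp := hab
    generalize a * b = p at hp hB
    obtain ⟨l, hl⟩ : ∃ l, h p = l * f p := ⟨h p / f p, by field_simp⟩
    have hgp : g p = -(l ^ 2 / 2) * f p := by
      have := hB p
      rw [hl] at this
      apply mul_left_cancel₀ hp
      linear_combination this / 2
    have hg : ∀ z, g z = l ^ 2 / 2 * f z - l * h z := fun z => by
      have := hB z
      rw [hl, hgp] at this
      apply mul_left_cancel₀ hp
      linear_combination this
    have hk : ∀ x y, f (x * σ y) = (h x - l * f x) * (h y - l * f y) := fun x y => by
      rw [hfgh, hg, hg]; ring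
    have hk0 : ∀ x, h x - l * f x = 0 := fun x => by
      have h1 := hk x (σ x)
      have h2 := hk (σ x) (σ x)
      have h3 := hk x x
      have h4 := anti x x
      have h5 := anti x (σ x)
      rw [hσinv] at h1 h2
      have h6 : (h x - l * f x) ^ 4 = 0 := by
        generalize h x - l * f x = u at *
        generalize h (σ x) - l * f (σ x) = v at *
        have huv : u * v = 0 := by linear_combination -h1 + h4 / 2
        have hsq : u ^ 2 = -v ^ 2 := by linear_combination -h3 + h5 - h2
        linear_combination u ^ 2 * hsq - u * v * huv
      exact pow_eq_zero_iff (by norm_num) |>.1 h6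
    have hf : ∀ x y, f (x * y) = 0 := fun x y => by
      have := hk x (σ y)
      rwa [hσinv, hk0, zero_mul] at this
    exact hab (hf a b)
  refine ⟨prod, ?_⟩
  obtain ⟨p, hp⟩ := Function.ne_iff.1 hf0
  rw [Pi.zero_apply] at hp
  have hB : ∀ x y, f x * g y + g x * f y + h x * h y = 0 := fun x y => by
    rw [← hfgh, prod]
  obtain ⟨l, hl⟩ : ∃ l, h p = l * f p := ⟨h p / f p, by field_simp⟩
  have hh : ∀ x, h x = l * f x := fun x => by
    have h1 : (f p * h x - f x * h p) ^ 2 = 0 := by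
      linear_combination f p ^ 2 * hB x x + f x ^ 2 * hB p p - 2 * f p * f x * hB p x
    have h2 := pow_eq_zero_iff (by norm_num) |>.1 h1
    apply mul_left_cancel₀ hp
    linear_combination h2 + f x * hl
  refine ⟨l, fun x => ?_, hh⟩
  have h1 := hB p x
  have h2 := hB p p
  rw [hh p, hh x] at h1
  rw [hh p] at h2
  have hgp : g p = -(l ^ 2 / 2) * f p := by
    apply mul_left_cancel₀ hp
    linear_combination h2 / 2
  rw [hgp] at h1
  apply mul_left_cancel₀ hp
  linear_combination h1
end

section
/- Let S be a semigroup, σ: S → S an involutive automorphism, and let f, g, h: S → ℂ satisfy f(xσ(y)) = f(x)g(y) + g(x)f(y) + h(x)h(y) for all x, y ∈ S. Suppose f^e is not identically zero on S² (i.e. f^e(ab) ≠ 0 for some a, b ∈ S) and h^e = λf^e for some constant λ ∈ ℂ. Then there exists a constant μ ∈ ℂ such that g^o + λh^o = μf^o, and moreover one of the following holds: (1) f^o = 0, g^o = −λh^o, and f^e(xy) = f^e(x)(g^e + (λ²/2)f^e)(y) + f^e(y)(g^e + (λ²/2)f^e)(x) − h^o(x)h^o(y) for all x, y ∈ S; (2)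 g^e = −μf^e, f^o(xy) = 0 for all x, y ∈ S, f^e(xy) + f^e(σ(y)x) = 2(λ² − 2μ)f^e(x)f^e(y) for all x, y ∈ S, and f^e(xσ(y)) = (λ² − 2μ)f^e(x)f^e(y) + 2μf^o(x)f^o(y) − λf^o(x)h^o(y) − λh^o(x)f^o(y) + h^o(x)h^o(y) for all x, y ∈ S. -/
theorem evenPart_apply_involution {S : Type*} {σ : S → S}
    (hσinv : ∀ x, σ (σ x) = x) (f : S → ℂ) (x : S) :
    evenPart σ f (σ x) = evenPart σ f x := by
  simp only [evenPart, hσinv]; ring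

theorem oddPart_apply_involution {S : Type*} {σ : S → S}
    (hσinv : ∀ x, σ (σ x) = x) (f : S → ℂ) (x : S) :
    oddPart σ f (σ x) = -oddPart σ f x := by
  simp only [oddPart, hσinv]; ring

/-- A function that is anticommutative on products vanishes on triple products. -/
theorem eq_zero_on_triple_of_anticomm {S : Type*} [Semigroup S] {φ : S → ℂ}
    (hφ : ∀ x y, φ (x * y) = -φ (y * x)) (x y z : S) : φ (x * (y * z)) = 0 := by
  have h₁ := hφ x (y * z)
  have h₂ := hφ y (z * x)
  have h₃ := hφ z (x * y)
  simp only [mul_assoc] at h₁ h₂ h₃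
  linear_combination (h₁ - h₂ + h₃) / 2

theorem lemma_fe_nonzero_on_S2 {S : Type*} [Semigroup S] (σ : S → S)
    (hσmul : ∀ x y : S, σ (x * y) = σ x * σ y) (hσinv : ∀ x : S, σ (σ x) = x)
    (f g h : S → ℂ) (lam : ℂ)
    (hfgh : ∀ x y : S, f (x * σ y) = f x * g y + g x * f y + h x * h y)
    (hfeS2 : ∃ a b : S, evenPart σ f (a * b) ≠ 0)
    (hhe : ∀ x : S, evenPart σ h x = lam * evenPart σ f x) :
    ∃ μ : ℂ,
      (∀ x : S, oddPart σ g x + lam * oddPart σ h x = μ * oddPart σ f x) ∧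
      (((oddPart σ f = 0) ∧
        (∀ x : S, oddPart σ g x = -lam * oddPart σ h x) ∧
        (∀ x y : S, evenPart σ f (x * y) =
          evenPart σ f x * (evenPart σ g y + (lam ^ 2 / 2) * evenPart σ f y) +
            evenPart σ f y * (evenPart σ g x + (lam ^ 2 / 2) * evenPart σ f x) -
              oddPart σ h x * oddPart σ h y)) ∨
       ((∀ x : S, evenPart σ g x = -μ * evenPart σ f x) ∧
        (∀ x y : S, oddPart σ f (x * y) = 0) ∧
        (∀ x y : S, evenPart σ f (x * y) + evenPart σ f (σ y * x) =
          2 * (lam ^ 2 - 2 * μ) * evenPart σ f x * evenPart σ f y) ∧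
        (∀ x y : S, evenPart σ f (x * σ y) =
          (lam ^ 2 - 2 * μ) * evenPart σ f x * evenPart σ f y +
            2 * μ * oddPart σ f x * oddPart σ f y -
            lam * oddPart σ f x * oddPart σ h y -
            lam * oddPart σ h x * oddPart σ f y +
            oddPart σ h x * oddPart σ h y))) := by
  have even_map := evenPart_apply_involution hσinv
  have odd_map := oddPart_apply_involution hσinv
  have even_mul : ∀ x y, evenPart σ f (x * σ y) =
      evenPart σ f x * evenPart σ g y + evenPart σ g x * evenPart σ f y +
        lam ^ 2 * evenPart σ f x * evenPart σ f y +
        oddPart σ f x * oddPart σ g y + oddPart σ g x * oddPart σ f y +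
        oddPart σ h x * oddPart σ h y := by
    intro x y
    have key : evenPart σ f (x * σ y) =
        evenPart σ f x * evenPart σ g y + evenPart σ g x * evenPart σ f y +
          evenPart σ h x * evenPart σ h y +
          oddPart σ f x * oddPart σ g y + oddPart σ g x * oddPart σ f y +
          oddPart σ h x * oddPart σ h y := by
      simp only [evenPart, oddPart, hσmul, hfgh]; ring
    rw [key, hhe, hhe]; ring
  have odd_mul : ∀ x y, oddPart σ f (x * σ y) =
      evenPart σ f x * (oddPart σ g y + lam * oddPart σ h y) +
        oddPart σ f x * evenPart σ g y +
        (oddPart σ g x + lam * oddPart σ h x) * evenPart σ f y +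
        evenPart σ g x * oddPart σ f y := by
    intro x y
    have key : oddPart σ f (x * σ y) =
        evenPart σ f x * oddPart σ g y + oddPart σ f x * evenPart σ g y +
          oddPart σ g x * evenPart σ f y + evenPart σ g x * oddPart σ f y +
          evenPart σ h x * oddPart σ h y + oddPart σ h x * evenPart σ h y := by
      simp only [evenPart, oddPart, hσmul, hfgh]; ring
    rw [key, hhe, hhe]; ring
  have even_mul' : ∀ x y, evenPart σ f (x * y) =
      evenPart σ f x * evenPart σ g y + evenPart σ g x * evenPart σ f y +
        lam ^ 2 * evenPart σ f x * evenPart σ f y -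
        oddPart σ f x * oddPart σ g y - oddPart σ g x * oddPart σ f y -
        oddPart σ h x * oddPart σ h y := by
    intro x y
    have := even_mul x (σ y)
    simp only [hσinv, even_map, odd_map] at this
    rw [this]; ring
  have odd_mul' : ∀ x y, oddPart σ f (x * y) =
      -evenPart σ f x * (oddPart σ g y + lam * oddPart σ h y) +
        oddPart σ f x * evenPart σ g y +
        (oddPart σ g x + lam * oddPart σ h x) * evenPart σ f y -
        evenPart σ g x * oddPart σ f y := by
    intro x y
    have := odd_mul x (σ y)
    simp only [hσinv, even_map, odd_map] at this
    rw [this]; ring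
  have even_comm : ∀ x y, evenPart σ f (x * y) = evenPart σ f (y * x) := by
    intro x y
    rw [even_mul' x y, even_mul' y x]; ring
  have odd_triple := eq_zero_on_triple_of_anticomm (φ := oddPart σ f) fun x y => by
    rw [odd_mul' x y, odd_mul' y x]; ring
  have triple_odd : ∀ x y z, oddPart σ f x * evenPart σ g (y * z) +
      (oddPart σ g x + lam * oddPart σ h x) * evenPart σ f (y * z) = 0 := by
    intro x y z
    have h₁ := odd_mul' x (y * z)
    have h₂ := odd_mul' (σ x) (y * z)
    rw [odd_triple] at h₁ h₂
    simp only [even_map, odd_map] at h₂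
    linear_combination (h₂ - h₁) / 2
  have triple_even : ∀ x y z, evenPart σ f x *
      (oddPart σ g (y * z) + lam * oddPart σ h (y * z)) +
        evenPart σ g x * oddPart σ f (y * z) = 0 := by
    intro x y z
    have h₁ := odd_mul' x (y * z)
    rw [odd_triple] at h₁
    linear_combination h₁ + triple_odd x y z
  obtain ⟨a, b, hab⟩ := hfeS2
  obtain ⟨μ, hμ⟩ : ∃ μ : ℂ, ∀ x, oddPart σ g x + lam * oddPart σ h x = μ * oddPart σ f x := by
    refine ⟨-evenPart σ g (a * b) / evenPart σ f (a * b), fun x => ?_⟩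
    field_simp
    linear_combination triple_odd x a b
  have odd_zero : ∀ x y, oddPart σ f (x * y) = 0 := by
    intro x y
    by_contra hne
    have hP : ∀ z, evenPart σ g z + μ * evenPart σ f z = 0 := fun z => by
      have := triple_even z x y
      rw [hμ] at this
      exact (mul_eq_zero.mp (by linear_combination this)).resolve_right hne
    apply hne
    rw [odd_mul', hμ, hμ]
    linear_combination oddPart σ f x * hP y - oddPart σ f y * hP x
  refine ⟨μ, hμ, ?_⟩
  by_cases hf : oddPart σ f = 0
  · have hg : ∀ x, oddPart σ g x = -lam * oddPart σ h x := fun x => by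
      have := hμ x
      rw [hf, Pi.zero_apply] at this
      linear_combination this
    refine Or.inl ⟨hf, hg, fun x y => ?_⟩
    rw [even_mul', hf]
    simp only [Pi.zero_apply]
    ring
  · obtain ⟨c, hc⟩ := Function.ne_iff.mp hf
    rw [Pi.zero_apply] at hc
    have hG : ∀ x, evenPart σ g x = -μ * evenPart σ f x := fun x => by
      have h₁ := odd_mul x c
      have h₂ := odd_mul' x c
      rw [odd_zero, hμ, hμ] at h₁ h₂
      apply mul_right_cancel₀ hc
      linear_combination (h₂ - h₁) / 2
    have hg : ∀ x, oddPart σ g x = μ * oddPart σ f x - lam * oddPart σ h x := fun x => by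
      linear_combination hμ x
    refine Or.inr ⟨hG, odd_zero, fun x y => ?_, fun x y => ?_⟩
    · rw [even_comm (σ y) x, even_mul, even_mul', hG, hG]; ring
    · rw [even_mul, hG, hG, hg, hg]; ring
end

section
/- Let S be a semigroup, σ: S → S an involutive automorphism, and let f, g, h: S → ℂ satisfy f(xσ(y)) = f(x)g(y) + g(x)f(y) + h(x)h(y) for all x, y ∈ S. Suppose f^e ≠ 0, f^e(xy) = 0 for all x, y ∈ S, and h^e = λf^e for some constant λ ∈ ℂ. Then g^e = −(λ²/2)f^e. -/
theorem even_g_formula {S : Type*} [Semigroup S] (σ : S → S)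
    (hσmul : ∀ x y : S, σ (x * y) = σ x * σ y) (hσinv : ∀ x : S, σ (σ x) = x)
    (f g h : S → ℂ) (lam : ℂ)
    (hfgh : ∀ x y : S, f (x * σ y) = f x * g y + g x * f y + h x * h y)
    (hfe : evenPart σ f ≠ 0)
    (hfeS2 : ∀ x y : S, evenPart σ f (x * y) = 0)
    (hhe : ∀ x : S, evenPart σ h x = lam * evenPart σ f x) :
    ∀ x : S, evenPart σ g x = -(lam ^ 2 / 2) * evenPart σ f x := by
  have sum_eq_zero (x y : S) :
      f x * g y + g x * f y + h x * h y +
        (f (σ x) * g (σ y) + g (σ x) * f (σ y) + h (σ x) * h (σ y)) = 0 := by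
    have hxy := hfeS2 x (σ y)
    simp only [evenPart, hσmul, hfgh] at hxy
    linear_combination 2 * hxy
  have even_identity (x y : S) :
      evenPart σ f x * evenPart σ g y + evenPart σ g x * evenPart σ f y +
        lam ^ 2 * (evenPart σ f x * evenPart σ f y) = 0 := by
    have hx := hhe x
    have hy := hhe y
    have h₁ := sum_eq_zero x y
    have h₂ := sum_eq_zero x (σ y)
    rw [hσinv] at h₂
    have hsum : evenPart σ f x * evenPart σ g y + evenPart σ g x * evenPart σ f y +
        evenPart σ h x * evenPart σ h y = 0 := by
      simp only [evenPart]
      linear_combination (h₁ + h₂) / 4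
    rw [hx, hy] at hsum
    linear_combination hsum
  obtain ⟨a, ha⟩ := Function.ne_iff.mp hfe
  simp only [Pi.zero_apply] at ha
  have hga : evenPart σ g a = -(lam ^ 2 / 2) * evenPart σ f a := by
    apply mul_left_cancel₀ ha
    linear_combination even_identity a a / 2
  intro x
  apply mul_left_cancel₀ ha
  linear_combination even_identity a x - evenPart σ f x * hga
end

section
/- Let S be a semigroup, σ: S → S an involutive automorphism, and let f, g, h: S → ℂ satisfy f(xσ(y)) = f(x)g(y) + g(x)f(y) + h(x)h(y) for all x, y ∈ S. Suppose f^e ≠ 0, f^e(xy) = 0 for all x, y ∈ S, and h^e = λf^e for some constant λ ∈ ℂ. Then f^o(xσ(y)) = k(x)f^e(y) + f^e(x)k(y) for all x, y ∈ S, where k := −(λ²/2)f^o + g^o + λh^o. -/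
theorem evenPart_tensor_identity {S : Type*} [Semigroup S] {σ : S → S}
    (hσmul : ∀ x y : S, σ (x * y) = σ x * σ y) (hσinv : ∀ x : S, σ (σ x) = x)
    {f g h : S → ℂ}
    (hfgh : ∀ x y : S, f (x * σ y) = f x * g y + g x * f y + h x * h y)
    (hfeS2 : ∀ x y : S, evenPart σ f (x * y) = 0) (x y : S) :
    evenPart σ f x * evenPart σ g y + evenPart σ g x * evenPart σ f y +
      evenPart σ h x * evenPart σ h y = 0 := by
  have h₁ := hfeS2 x (σ y)
  have h₂ := hfeS2 x y
  have e := hfgh x (σ y)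
  have e' := hfgh (σ x) (σ y)
  simp only [evenPart, hσmul, hσinv] at h₁ h₂ e e' ⊢
  rw [hfgh x y, e'] at h₁
  rw [e, hfgh (σ x) y] at h₂
  linear_combination h₁ / 2 + h₂ / 2

/-- If `a` is nonzero and its symmetrized tensor product with `c` is `-μ` times `a ⊗ a`, then
`c = -(μ / 2) a`. -/
theorem eq_neg_half_mul_of_symm_tensor {S : Type*} {a c : S → ℂ} {μ : ℂ} (ha : a ≠ 0)
    (hac : ∀ x y : S, a x * c y + c x * a y + μ * (a x * a y) = 0) (x : S) :
    c x = -(μ / 2) * a x := by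
  obtain ⟨z, hz⟩ := Function.ne_iff.mp ha
  have hcz : c z = -(μ / 2) * a z := by
    apply mul_left_cancel₀ hz
    linear_combination hac z z / 2
  apply mul_left_cancel₀ hz
  linear_combination hac z x - a x * hcz

theorem oddPart_sine_identity {S : Type*} [Semigroup S] (σ : S → S)
    (hσmul : ∀ x y : S, σ (x * y) = σ x * σ y) (hσinv : ∀ x : S, σ (σ x) = x)
    (f g h : S → ℂ) (lam : ℂ)
    (hfgh : ∀ x y : S, f (x * σ y) = f x * g y + g x * f y + h x * h y)
    (hfe : evenPart σ f ≠ 0)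
    (hfeS2 : ∀ x y : S, evenPart σ f (x * y) = 0)
    (hhe : ∀ x : S, evenPart σ h x = lam * evenPart σ f x) :
    ∀ x y : S, oddPart σ f (x * σ y) =
      (-(lam ^ 2 / 2) * oddPart σ f x + oddPart σ g x + lam * oddPart σ h x) * evenPart σ f y +
        evenPart σ f x *
          (-(lam ^ 2 / 2) * oddPart σ f y + oddPart σ g y + lam * oddPart σ h y) := by
  have hge : ∀ x, evenPart σ g x = -(lam ^ 2 / 2) * evenPart σ f x :=
    eq_neg_half_mul_of_symm_tensor hfe fun x y ↦ by
      have key := evenPart_tensor_identity hσmul hσinv hfgh hfeS2 x y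
      rw [hhe, hhe] at key
      linear_combination key
  intro x y
  have e := hfgh (σ x) (σ y)
  have hgx := hge x
  have hgy := hge y
  have hhx := hhe x
  have hhy := hhe y
  simp only [evenPart, oddPart, hσmul, hσinv] at e hgx hgy hhx hhy ⊢
  rw [hfgh x y, e]
  linear_combination (f x - f (σ x)) / 2 * hgy + (f y - f (σ y)) / 2 * hgx +
    (h x - h (σ x)) / 2 * hhy + (h y - h (σ y)) / 2 * hhx
end

section
/- Let S be a semigroup, σ: S → S an involutive automorphism, and let f, g, h: S → ℂ satisfy f(xσ(y)) = f(x)g(y) + g(x)f(y) + h(x)h(y) for all x, y ∈ S. Suppose f^e ≠ 0, f^e(xy) = 0 for all x, y ∈ S, and h^e = λf^e for some constant λ ∈ ℂ. Then f^o(x)g^o(y) + g^o(x)f^o(y) + h^o(x)h^o(y) = 0 for all x, y ∈ S. -/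
theorem oddParts_relation {S : Type*} [Semigroup S] (σ : S → S)
    (hσmul : ∀ x y : S, σ (x * y) = σ x * σ y) (hσinv : ∀ x : S, σ (σ x) = x)
    (f g h : S → ℂ) (lam : ℂ)
    (hfgh : ∀ x y : S, f (x * σ y) = f x * g y + g x * f y + h x * h y)
    (hfe : evenPart σ f ≠ 0)
    (hfeS2 : ∀ x y : S, evenPart σ f (x * y) = 0)
    (hhe : ∀ x : S, evenPart σ h x = lam * evenPart σ f x) :
    ∀ x y : S, oddPart σ f x * oddPart σ g y + oddPart σ g x * oddPart σ f y +
      oddPart σ h x * oddPart σ h y = 0 := by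
  intro x y
  have h₁ := hfeS2 x (σ y)
  have h₂ := hfeS2 x y
  simp only [evenPart, hσmul, hσinv] at h₁ h₂
  have k₁ := hfgh x y
  have k₂ := hfgh (σ x) (σ y)
  have k₃ := hfgh (σ x) y
  have k₄ := hfgh x (σ y)
  rw [hσinv] at k₂ k₄
  simp only [oddPart]
  linear_combination (h₁ - h₂) / 2 - (k₁ + k₂ - k₃ - k₄) / 4
end

section
/- Let S be a semigroup and σ: S → S an involutive automorphism. The triples of functions f, g, h: S → ℂ satisfying f(xσ(y)) = f(x)g(y) + g(x)f(y) + h(x)h(y) for all x, y ∈ S, such that h^e and f^e are linearly dependent and f^e(xy) = 0 for all x, y ∈ S, are exactly the following: (A) f = 0, h = 0, and g arbitrary; (B) f is any non-zero function with f(xy) = 0 for all x, y ∈ S, g = −(λ²/2)f and h = λf for some constant λ ∈ ℂ. -/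
/-- If the symmetric form `f x * g y + g x * f y + h x * h y` vanishes on `{p} × S` and `f p ≠ 0`,
then it is the square of the linear combination `h - (h p / f p) • f`. -/
theorem symmetric_form_eq_square {S : Type*} {f g h : S → ℂ} {p : S} (hp : f p ≠ 0)
    (hzero : ∀ x, f p * g x + g p * f x + h p * h x = 0) :
    (∀ x, g x = (h p / f p) ^ 2 / 2 * f x - h p / f p * h x) ∧
      ∀ x y, f x * g y + g x * f y + h x * h y =
        (h x - h p / f p * f x) * (h y - h p / f p * f y) := by
  obtain ⟨lam, hlam⟩ : ∃ lam, lam = h p / f p := ⟨_, rfl⟩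
  rw [← hlam]
  have hhp : h p = lam * f p := by rw [hlam]; field_simp
  have hgp : g p = -(lam ^ 2 / 2) * f p := by
    have := hzero p
    rw [hhp] at this
    apply mul_left_cancel₀ hp
    linear_combination this / 2
  have hg : ∀ x, g x = lam ^ 2 / 2 * f x - lam * h x := by
    intro x
    have := hzero x
    rw [hhp, hgp] at this
    apply mul_left_cancel₀ hp
    linear_combination this
  refine ⟨hg, fun x y => ?_⟩
  rw [hg x, hg y]
  ring

/-- If `f (x * σ y)` is symmetric in `x, y` and `f^e` vanishes on products, then `f` is
antisymmetric on products. -/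
theorem mul_antisymm_of_evenPart_eq_zero {S : Type*} [Semigroup S] {σ : S → S}
    (hσmul : ∀ x y : S, σ (x * y) = σ x * σ y) (hσinv : ∀ x : S, σ (σ x) = x) {f : S → ℂ}
    (hsymm : ∀ x y, f (x * σ y) = f (y * σ x)) (heven : ∀ x y : S, evenPart σ f (x * y) = 0)
    (x y : S) : f (x * y) = -f (y * x) := by
  have hs := hsymm x (σ y)
  have he := heven y x
  rw [hσinv] at hs
  simp only [evenPart, hσmul] at he
  rw [hs]
  linear_combination 2 * he

/-- A function that is antisymmetric on products vanishes on triple products. -/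
theorem triple_mul_eq_zero_of_antisymm {S : Type*} [Semigroup S] {f : S → ℂ}
    (hanti : ∀ x y : S, f (x * y) = -f (y * x)) (x y z : S) : f (x * y * z) = 0 := by
  have h1 := hanti (x * y) z
  have h2 := hanti (z * x) y
  have h3 := hanti (y * z) x
  simp only [mul_assoc] at h1 h2 h3 ⊢
  linear_combination (h1 - h2 + h3) / 2

theorem mul_eq_zero_of_evenPart_eq_zero {S : Type*} [Semigroup S] {σ : S → S}
    (hσmul : ∀ x y : S, σ (x * y) = σ x * σ y) (hσinv : ∀ x : S, σ (σ x) = x) {f g h : S → ℂ}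
    (heq : ∀ x y : S, f (x * σ y) = f x * g y + g x * f y + h x * h y)
    (heven : ∀ x y : S, evenPart σ f (x * y) = 0) (a b : S) : f (a * b) = 0 := by
  by_contra hp
  have hanti := mul_antisymm_of_evenPart_eq_zero hσmul hσinv
    (fun x y => by rw [heq, heq]; ring) heven
  obtain ⟨-, hsq⟩ := symmetric_form_eq_square (g := g) (h := h) hp
    (fun x => (heq _ _).symm.trans (triple_mul_eq_zero_of_antisymm hanti _ _ _))
  obtain ⟨H, hH⟩ : ∃ H : S → ℂ, ∀ x y, f (x * y) = H x * H (σ y) :=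
    ⟨_, fun x y => by simpa only [hσinv] using (heq x (σ y)).trans (hsq x (σ y))⟩
  have haa := hanti a a
  have hab := hanti a b
  simp only [hH] at haa hab
  rw [hH] at hp
  have hz : (H a * H (σ b)) ^ 2 = 0 := by
    linear_combination H a * H (σ b) * hab - H b * H (σ b) * haa / 2
  exact hp (pow_eq_zero_iff two_ne_zero |>.mp hz)

theorem solutions_he_fe_dependent_fe_zero_on_S2 {S : Type*} [Semigroup S] (σ : S → S)
    (hσmul : ∀ x y : S, σ (x * y) = σ x * σ y) (hσinv : ∀ x : S, σ (σ x) = x)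
    (f g h : S → ℂ) :
    ((∀ x y : S, f (x * σ y) = f x * g y + g x * f y + h x * h y) ∧
      ((∃ c : ℂ, ∀ x : S, evenPart σ h x = c * evenPart σ f x) ∨
        (∃ c : ℂ, ∀ x : S, evenPart σ f x = c * evenPart σ h x)) ∧
      (∀ x y : S, evenPart σ f (x * y) = 0)) ↔
    ((f = 0 ∧ h = 0) ∨
      (f ≠ 0 ∧ (∀ x y : S, f (x * y) = 0) ∧
        ∃ lam : ℂ, (∀ x : S, g x = -(lam ^ 2 / 2) * f x) ∧ (∀ x : S, h x = lam * f x))) := by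
  constructor
  · rintro ⟨heq, -, heven⟩
    by_cases hf : f = 0
    · refine Or.inl ⟨hf, funext fun x => ?_⟩
      simpa [hf] using heq x x
    · have hmul := mul_eq_zero_of_evenPart_eq_zero hσmul hσinv heq heven
      obtain ⟨p, hp⟩ := Function.ne_iff.mp hf
      have hzero : ∀ x y, f x * g y + g x * f y + h x * h y = 0 :=
        fun x y => (heq x y).symm.trans (hmul _ _)
      obtain ⟨hg, hsq⟩ := symmetric_form_eq_square hp (hzero p)
      have hh : ∀ x, h x = h p / f p * f x := fun x =>
        sub_eq_zero.mp (mul_self_eq_zero.mp ((hsq x x).symm.trans (hzero x x)))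
      refine Or.inr ⟨hf, hmul, h p / f p, fun x => ?_, hh⟩
      linear_combination hg x - h p / f p * hh x
  · rintro (⟨rfl, rfl⟩ | ⟨-, hmul, lam, hg, hh⟩)
    · simp [evenPart]
    · refine ⟨fun x y => ?_, Or.inl ⟨lam, fun x => ?_⟩, fun x y => ?_⟩
      · rw [hmul, hg, hg, hh, hh]
        ring
      · simp only [evenPart, hh]
        ring
      · simp [evenPart, hσmul, hmul]
end

section
/- Let S be a semigroup and σ: S → S an involutive automorphism. Let χ₁, χ₂, χ₃: S → ℂ be three distinct non-zero multiplicative functions with χ₁∘σ = χ₁, χ₂∘σ = χ₂, χ₃∘σ = χ₃, and let α, λ, ρ ∈ ℂ∖{0} be constants with 2αλ²ρ(2 − ρ) = 1. Define f := αρχ₁ + α(2 − ρ)χ₂ − 2αχ₃, g := (ρ/4)χ₁ + ((2 − ρ)/4)χ₂ + (1/2)χ₃, and h := (1/(2λ))(χ₁ − χ₂). Then f(xσ(y)) = f(x)g(y) + g(x)f(y) + h(x)h(y) for all x, y ∈ S. -/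
theorem three_multiplicative_solution {S : Type*} [Semigroup S] (σ : S → S)
    (hσmul : ∀ x y : S, σ (x * y) = σ x * σ y) (hσinv : ∀ x : S, σ (σ x) = x)
    (χ₁ χ₂ χ₃ : S → ℂ)
    (hχ₁ : ∀ x y : S, χ₁ (x * y) = χ₁ x * χ₁ y)
    (hχ₂ : ∀ x y : S, χ₂ (x * y) = χ₂ x * χ₂ y)
    (hχ₃ : ∀ x y : S, χ₃ (x * y) = χ₃ x * χ₃ y)
    (hχ₁0 : χ₁ ≠ 0) (hχ₂0 : χ₂ ≠ 0) (hχ₃0 : χ₃ ≠ 0)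
    (h12 : χ₁ ≠ χ₂) (h13 : χ₁ ≠ χ₃) (h23 : χ₂ ≠ χ₃)
    (hχ₁σ : ∀ x : S, χ₁ (σ x) = χ₁ x)
    (hχ₂σ : ∀ x : S, χ₂ (σ x) = χ₂ x)
    (hχ₃σ : ∀ x : S, χ₃ (σ x) = χ₃ x)
    (α lam ρ : ℂ) (hα : α ≠ 0) (hlam : lam ≠ 0) (hρ : ρ ≠ 0)
    (hconstraint : 2 * α * lam ^ 2 * ρ * (2 - ρ) = 1)
    (f g h : S → ℂ)
    (hf : f = fun x => α * ρ * χ₁ x + α * (2 - ρ) * χ₂ x - 2 * α * χ₃ x)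
    (hg : g = fun x => (ρ / 4) * χ₁ x + ((2 - ρ) / 4) * χ₂ x + (1 / 2) * χ₃ x)
    (hh : h = fun x => (1 / (2 * lam)) * (χ₁ x - χ₂ x)) :
    ∀ x y : S, f (x * σ y) = f x * g y + g x * f y + h x * h y := by
  intro x y
  have hk : (1 / (2 * lam)) ^ 2 = α * ρ * (2 - ρ) / 2 := by
    field_simp
    linear_combination -hconstraint
  subst hf hg hh
  simp only [hχ₁, hχ₂, hχ₃, hχ₁σ, hχ₂σ, hχ₃σ]
  linear_combination -(χ₁ x - χ₂ x) * (χ₁ y - χ₂ y) * hk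
end

section
/- Let S be a semigroup and σ: S → S an involutive automorphism. Let Φ₀, Ψ₀, k: S → ℂ be functions such that Φ₀(xy) = 0 for all x, y ∈ S, Ψ₀(xσ(y)) = Φ₀(x)Φ₀(y) for all x, y ∈ S, Φ₀∘σ = Φ₀, Ψ₀∘σ = Ψ₀, k(xy) = 0 for all x, y ∈ S, and k∘σ = −k, and let β ∈ ℂ be a constant. Define f := Ψ₀ + k, g := −(β²/2)Ψ₀ + βΦ₀ − (β²/2)k, and h := −βΨ₀ + Φ₀ − βk. Then f(xσ(y)) = f(x)g(y) + g(x)f(y) + h(x)h(y) for all x, y ∈ S. -/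
theorem degenerate_cosine_sine_solution {S : Type*} [Semigroup S] (σ : S → S)
    (hσmul : ∀ x y : S, σ (x * y) = σ x * σ y) (hσinv : ∀ x : S, σ (σ x) = x)
    (Φ₀ Ψ₀ k : S → ℂ)
    (hΦ₀ : ∀ x y : S, Φ₀ (x * y) = 0)
    (hΨ₀ : ∀ x y : S, Ψ₀ (x * σ y) = Φ₀ x * Φ₀ y)
    (hΦ₀σ : ∀ x : S, Φ₀ (σ x) = Φ₀ x)
    (hΨ₀σ : ∀ x : S, Ψ₀ (σ x) = Ψ₀ x)
    (hk : ∀ x y : S, k (x * y) = 0)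
    (hkσ : ∀ x : S, k (σ x) = - k x)
    (β : ℂ) (f g h : S → ℂ)
    (hf : f = fun x => Ψ₀ x + k x)
    (hg : g = fun x => -(β ^ 2 / 2) * Ψ₀ x + β * Φ₀ x - (β ^ 2 / 2) * k x)
    (hh : h = fun x => -β * Ψ₀ x + Φ₀ x - β * k x) :
    ∀ x y : S, f (x * σ y) = f x * g y + g x * f y + h x * h y := by
  intro x y
  simp only [hf, hg, hh, hΨ₀, hk]
  ring
end

section
/- Let S be a semigroup, σ: S → S an involutive automorphism, and let f, l: S → ℂ satisfy f(xσ(y)) = l(x)l(y) for all x, y ∈ S. If the odd part l^o of l is non-zero and the even part l^e of l is non-zero, then l(xy) = 0 for all x, y ∈ S. -/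
theorem square_eq_vanishes_on_products {S : Type*} [Semigroup S] (σ : S → S)
    (hσmul : ∀ x y : S, σ (x * y) = σ x * σ y) (hσinv : ∀ x : S, σ (σ x) = x)
    (f l : S → ℂ)
    (hfl : ∀ x y : S, f (x * σ y) = l x * l y)
    (hlo : oddPart σ l ≠ 0) (hle : evenPart σ l ≠ 0) :
    ∀ x y : S, l (x * y) = 0 := by
  have hassoc : ∀ x y z, l (x * y) * l (σ z) = l x * l (σ (y * z)) := fun x y z => by
    rw [← hfl, ← hfl, hσinv, hσinv, mul_assoc]
  obtain ⟨a, ha⟩ : ∃ a, l a ≠ 0 := by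
    by_contra! h
    exact hlo (funext fun x => by simp [oddPart, h])
  obtain ⟨m, hm⟩ : ∃ m : S → ℂ, ∀ x y, l (x * y) = l x * m y := by
    refine ⟨fun y => l (σ (y * σ a)) / l a, fun x y => ?_⟩
    have h := hassoc x y (σ a)
    rw [hσinv] at h
    rw [← mul_div_assoc, eq_div_iff ha, h]
  have hm' : ∀ y z, l (y * z) = m (σ y) * l z := fun y z => by
    have h := hassoc a (σ y) (σ z)
    rw [hm, hσmul, hσinv, hσinv, mul_assoc] at h
    exact (mul_left_cancel₀ ha h).symm
  have hlm : ∀ x y, l x * m y = m (σ x) * l y := fun x y => by rw [← hm, hm']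
  suffices h : ∀ y, m y = 0 from fun x y => by rw [hm, h, mul_zero]
  by_contra! ⟨b, hb⟩
  have hab : m (σ a) * l b ≠ 0 := hlm a b ▸ mul_ne_zero ha hb
  have hσm : ∀ y, m (σ y) = m y := fun y => mul_left_cancel₀ hab (by
    linear_combination m y * hlm a b - m b * hlm a y - m (σ a) * hlm y b)
  refine hlo (funext fun x => ?_)
  have hx : l x = l (σ x) := mul_right_cancel₀ hb (by
    rw [hlm, hlm, hσinv, hσm])
  simp [oddPart, ← hx]
end
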